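/- There is a universal constant K > 0 such that for any probability measure μ on ℝ, any n₀ ≥ 1, and any x₀ ∈ ℝ, |μ[x₀,∞) - σ₂[x₀,∞)| ≤ K·(ρ(x₀;n₀)/n₀ + ρ(x₀;n₀)^{1/2}·Σ_{n=1}^{n₀} n^{-1}|∫_ℝ U_n(x) dμ(x)|), where ρ(x;n₀) = max(1-|x|, n₀^{-2}). -/

import Mathlib

open MeasureTheory Polynomial Real

/-- The semicircle probability measure `dσ₂(x) = (2/π)(1-x²)₊^{1/2} dx` on `[-1,1]`. -/
noncomputable def semicircleMeasure : Measure ℝ :=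
  volume.withDensity (fun x =>
    ENNReal.ofReal ((2 / π) * Real.sqrt (max (1 - x ^ 2) 0)))

/-- Polynomial interpolation of the indicator of a half line, with multiplicities: `P` takes the
value `0` on `L` and `1` on `R`, and the cofactors have a sign outside the gap between them. -/
theorem exists_hermite_heaviside (L R : Multiset ℝ) (h : ∀ a ∈ L, ∀ b ∈ R, a < b) :
    ∃ P S T : ℝ[X],
      P = (L.map fun a => X - C a).prod * S ∧
      1 - P = (R.map fun b => C b - X).prod * T ∧
      P.natDegree ≤ L.card + R.card - 1 ∧
      (∀ x : ℝ, (∀ b ∈ R, x ≤ b) → 0 ≤ S.eval x) ∧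
      (∀ x : ℝ, (∀ a ∈ L, a ≤ x) → 0 ≤ T.eval x) := by
  induction L using Multiset.induction_on generalizing R with
  | empty =>
    exact ⟨1, 1, 0, by simp, by simp, by simp, by simp, by simp⟩
  | cons a L ihL =>
    induction R using Multiset.induction_on with
    | empty => exact ⟨0, 0, 1, by simp, by simp, by simp, by simp, by simp⟩
    | cons b R ihR =>
      obtain ⟨P₁, S₁, T₁, hS₁, hT₁, hd₁, hSp₁, hTp₁⟩ :=
        ihL (b ::ₘ R) fun x hx y hy => h x (Multiset.mem_cons_of_mem hx) y hy
      obtain ⟨P₂, S₂, T₂, hS₂, hT₂, hd₂, hSp₂, hTp₂⟩ :=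
        ihR fun x hx y hy => h x hx y (Multiset.mem_cons_of_mem hy)
      have hab : 0 < b - a :=
        sub_pos.2 (h a (Multiset.mem_cons_self a L) b (Multiset.mem_cons_self b R))
      have hinv : (C (b - a)⁻¹ : ℝ[X]) * (C b - C a) = 1 := by
        rw [← C_sub, ← C_mul, inv_mul_cancel₀ hab.ne', C_1]
      refine ⟨C (b - a)⁻¹ * ((X - C a) * P₁ + (C b - X) * P₂), C (b - a)⁻¹ * (S₁ + (C b - X) * S₂),
        C (b - a)⁻¹ * ((X - C a) * T₁ + T₂), ?_, ?_, ?_, ?_, ?_⟩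
      · rw [hS₁, hS₂]
        simp only [Multiset.map_cons, Multiset.prod_cons]
        ring
      · have : 1 - C (b - a)⁻¹ * ((X - C a) * P₁ + (C b - X) * P₂) =
            C (b - a)⁻¹ * ((X - C a) * (1 - P₁) + (C b - X) * (1 - P₂)) := by
          linear_combination -hinv
        rw [this, hT₁, hT₂]
        simp only [Multiset.map_cons, Multiset.prod_cons]
        ring
      · simp only [Multiset.card_cons] at hd₁ hd₂ ⊢
        refine (natDegree_C_mul_le _ _).trans (natDegree_add_le_of_degree_le ?_ ?_)
        · refine natDegree_mul_le.trans ?_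
          have : (X - C a).natDegree ≤ 1 := natDegree_X_sub_C_le a
          omega
        · refine natDegree_mul_le.trans ?_
          have : (C b - X).natDegree ≤ 1 := by
            rw [← natDegree_neg, neg_sub]; exact natDegree_X_sub_C_le b
          omega
      · intro x hx
        have h1 := hSp₁ x hx
        have h2 := hSp₂ x fun y hy => hx y (Multiset.mem_cons_of_mem hy)
        have h3 := hx b (Multiset.mem_cons_self b R)
        simp only [eval_mul, eval_C, eval_add, eval_sub, eval_X]
        exact mul_nonneg (inv_nonneg.2 hab.le)
          (add_nonneg h1 (mul_nonneg (sub_nonneg.2 h3) h2))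
      · intro x hx
        have h1 := hTp₁ x fun y hy => hx y (Multiset.mem_cons_of_mem hy)
        have h2 := hTp₂ x hx
        have h3 := hx a (Multiset.mem_cons_self a L)
        simp only [eval_mul, eval_C, eval_add, eval_sub, eval_X]
        exact mul_nonneg (inv_nonneg.2 hab.le)
          (add_nonneg (mul_nonneg (sub_nonneg.2 h3) h1) h2)

/-- One-sided polynomial approximations `P`, `M` of the indicator of `[ξ, ∞)` touching it at the
points of `l ∪ r`, with `P - M` equal to `1` at `ξ` and vanishing doubly on `l ∪ r`. -/
theorem exists_markov_stieltjes (l r : Finset ℝ) (ξ : ℝ) (hl : ∀ a ∈ l, a < ξ)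
    (hr : ∀ b ∈ r, ξ < b) :
    ∃ P M : ℝ[X], ∃ c : ℝ,
      P.natDegree ≤ 2 * (l.card + r.card) ∧ M.natDegree ≤ 2 * (l.card + r.card) ∧
      (∀ x ≤ ξ, 0 ≤ P.eval x ∧ M.eval x ≤ 0) ∧ (∀ x, ξ ≤ x → 1 ≤ P.eval x ∧ M.eval x ≤ 1) ∧
      P - M = C c * ((∏ a ∈ l, (X - C a)) * ∏ b ∈ r, (X - C b)) ^ 2 ∧
      (P - M).eval ξ = 1 := by
  obtain ⟨P, S, T, hS, hT, hd, hSp, hTp⟩ := exists_hermite_heaviside (l.val + l.val)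
    (ξ ::ₘ (r.val + r.val)) (by
      intro a ha b hb
      simp only [Multiset.mem_add, Multiset.mem_cons, Finset.mem_val, or_self] at ha hb
      rcases hb with rfl | hb
      · exact hl a ha
      · exact (hl a ha).trans (hr b hb))
  obtain ⟨M, S', T', hS', hT', hd', hSp', hTp'⟩ := exists_hermite_heaviside
    (ξ ::ₘ (l.val + l.val)) (r.val + r.val) (by
      intro a ha b hb
      simp only [Multiset.mem_add, Multiset.mem_cons, Finset.mem_val, or_self] at ha hb
      rcases ha with rfl | ha
      · exact hr b hb
      · exact (hl a ha).trans (hr b hb))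
  have hlprod : ((l.val + l.val).map fun a => (X - C a : ℝ[X])).prod =
      (∏ a ∈ l, (X - C a)) ^ 2 := by
    rw [Multiset.map_add, Multiset.prod_add, sq]; rfl
  have hrprod : ((r.val + r.val).map fun b => (C b - X : ℝ[X])).prod =
      (∏ b ∈ r, (X - C b)) ^ 2 := by
    rw [Multiset.map_add, Multiset.prod_add, ← sq]
    change (∏ b ∈ r, (C b - X : ℝ[X])) ^ 2 = _
    rw [← Finset.prod_pow, ← Finset.prod_pow]
    exact Finset.prod_congr rfl fun b _ => by ring
  simp only [Multiset.map_cons, Multiset.prod_cons, hlprod, hrprod] at hS hT hS' hT'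
  simp only [Multiset.mem_add, Multiset.mem_cons, Finset.mem_val, or_self,
    forall_eq_or_imp, Multiset.card_cons, Multiset.card_add, Finset.card_val] at *
  set A : ℝ[X] := ∏ a ∈ l, (X - C a) with hA
  set B : ℝ[X] := ∏ b ∈ r, (X - C b) with hB
  have hcop : IsCoprime (A ^ 2) (B ^ 2) := by
    refine IsCoprime.pow (IsCoprime.prod_left fun a ha => IsCoprime.prod_right fun b hb => ?_)
    exact pairwise_coprime_X_sub_C (s := id) Function.injective_id
      ((hl a ha).trans (hr b hb)).ne
  have hdvd : (A * B) ^ 2 ∣ P - M := by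
    rw [mul_pow]
    refine hcop.mul_dvd ⟨S - (X - C ξ) * S', ?_⟩ ⟨T' - (C ξ - X) * T, ?_⟩
    · rw [hS, hS']; ring
    · linear_combination hT' - hT
  have hABm : ((A * B) ^ 2).Monic :=
    ((monic_prod_X_sub_C _ _).mul (monic_prod_X_sub_C _ _)).pow 2
  have hABd : ((A * B) ^ 2).natDegree = 2 * (l.card + r.card) := by
    rw [Monic.natDegree_pow ((monic_prod_X_sub_C _ _).mul (monic_prod_X_sub_C _ _)),
      Monic.natDegree_mul (monic_prod_X_sub_C _ _) (monic_prod_X_sub_C _ _),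
      natDegree_finsetProd_X_sub_C_eq_card, natDegree_finsetProd_X_sub_C_eq_card]
  have hPd : P.natDegree ≤ 2 * (l.card + r.card) := by omega
  have hMd : M.natDegree ≤ 2 * (l.card + r.card) := by omega
  obtain ⟨W, hW⟩ := hdvd
  have hWd : W.natDegree = 0 := by
    by_cases h0 : W = 0
    · simp [h0]
    have h1 : (P - M).natDegree ≤ 2 * (l.card + r.card) := natDegree_sub_le_of_le hPd hMd |>.trans
      (by simp)
    rw [hW, hABm.natDegree_mul' h0, hABd] at h1
    omega
  obtain ⟨c, rfl⟩ := natDegree_eq_zero.1 hWd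
  refine ⟨P, M, c, hPd, hMd, fun x hx => ⟨?_, ?_⟩, fun x hx => ⟨?_, ?_⟩, by rw [hW, mul_comm], ?_⟩
  · rw [hS, eval_mul, eval_pow]
    exact mul_nonneg (sq_nonneg _) (hSp x ⟨hx, fun b hb => hx.trans (hr b hb).le⟩)
  · rw [hS', eval_mul, eval_mul, eval_pow, eval_sub, eval_X, eval_C]
    exact mul_nonpos_of_nonpos_of_nonneg
      (mul_nonpos_of_nonpos_of_nonneg (sub_nonpos.2 hx) (sq_nonneg _))
      (hSp' x fun b hb => hx.trans (hr b hb).le)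
  · have h1 := congrArg (eval x) hT
    rw [eval_mul, eval_mul, eval_pow, eval_sub, eval_sub, eval_X, eval_C, eval_one] at h1
    have h2 := mul_nonpos_of_nonpos_of_nonneg
      (mul_nonpos_of_nonpos_of_nonneg (sub_nonpos.2 hx) (sq_nonneg (eval x B)))
      (hTp x fun a ha => (hl a ha).le.trans hx)
    linarith
  · have h1 := congrArg (eval x) hT'
    rw [eval_mul, eval_pow, eval_sub, eval_one] at h1
    have h2 := mul_nonneg (sq_nonneg (eval x B))
      (hTp' x ⟨hx, fun a ha => (hl a ha).le.trans hx⟩)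
    linarith
  · have h1 := congrArg (eval ξ) hT
    have h2 := congrArg (eval ξ) hS'
    simp only [eval_mul, eval_sub, eval_one, eval_X, eval_C, sub_self, zero_mul] at h1 h2
    rw [eval_sub]; linarith

theorem sum_cos_add_cos_succ_eq_zero {N k : ℕ} (hk : 0 < k) (hkN : k < 2 * N) :
    ∑ j ∈ Finset.range N, (cos (k * (j * π / N)) + cos (k * ((j + 1 : ℕ) * π / N))) = 0 := by
  have hN : (0 : ℝ) < N := by
    have : 0 < N := by omega
    exact_mod_cast this
  have hk' : (0 : ℝ) < k := by exact_mod_cast hk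
  have hkN' : (k : ℝ) < 2 * N := by exact_mod_cast hkN
  have hs : 0 < sin (k * π / N / 2) := by
    apply sin_pos_of_pos_of_lt_pi (by positivity)
    rw [div_div, div_lt_iff₀ (by positivity)]
    nlinarith [pi_pos]
  have htel : ∀ j : ℕ, sin (k * π / N / 2) *
      (cos (k * (j * π / N)) + cos (k * ((j + 1 : ℕ) * π / N))) =
      cos (k * π / N / 2) *
        (sin (k * ((j + 1 : ℕ) * π / N)) - sin (k * (j * π / N))) := by
    intro j
    have h1 : k * (j * π / N) = (k * (j * π / N) + k * π / N / 2) - k * π / N / 2 := by ring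
    have h2 : k * ((j + 1 : ℕ) * π / N) = (k * (j * π / N) + k * π / N / 2) + k * π / N / 2 := by
      push_cast; ring
    rw [h2]
    generalize k * (j * π / N) + k * π / N / 2 = u at h1
    rw [h1, cos_add, cos_sub, sin_add, sin_sub]
    ring
  have hsum : sin (k * π / N / 2) *
      ∑ j ∈ Finset.range N, (cos (k * (j * π / N)) + cos (k * ((j + 1 : ℕ) * π / N))) = 0 := by
    rw [Finset.mul_sum, Finset.sum_congr rfl fun j _ => htel j, ← Finset.mul_sum,
      Finset.sum_range_sub fun j : ℕ => sin (k * (j * π / N))]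
    have : (k : ℝ) * (N * π / N) = k * π := by field_simp
    rw [this, sin_nat_mul_pi]
    simp
  exact (mul_eq_zero.1 hsum).resolve_left hs.ne'

theorem integral_cos_nat_mul_zero_pi {k : ℕ} (hk : k ≠ 0) : ∫ θ in 0..π, cos (k * θ) = 0 := by
  rw [intervalIntegral.integral_comp_mul_left _ (by exact_mod_cast hk), integral_cos]
  simp [sin_nat_mul_pi]

/-- The trapezoidal rule integrates even trigonometric polynomials of degree less than
`2 * N` exactly. -/
theorem integral_eval_cos_eq_trapezoid {N : ℕ} {P : ℝ[X]} (hP : P.natDegree < 2 * N) :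
    ∫ θ in 0..π, P.eval (cos θ) = π / (2 * N) * ∑ j ∈ Finset.range N,
      (P.eval (cos (j * π / N)) + P.eval (cos ((j + 1 : ℕ) * π / N))) := by
  have hN : N ≠ 0 := by omega
  have hmem : P ∈ degreeLT ℝ (2 * N) := by
    rw [mem_degreeLT]
    exact (degree_le_natDegree).trans_lt (by exact_mod_cast hP)
  clear hP
  rw [← Sequence.span_degreeLT (Chebyshev.chebyshevTsequence ℝ) (by simp)] at hmem
  induction hmem using Submodule.span_induction with
  | mem x h =>
    obtain ⟨k, hk, rfl⟩ := h
    have hev : ∀ θ, ((Chebyshev.chebyshevTsequence ℝ) k).eval (cos θ) = cos (k * θ) := fun θ => by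
      exact_mod_cast Chebyshev.T_real_cos θ k
    simp only [hev]
    rcases Nat.eq_zero_or_pos k with rfl | hk0
    · have : (N : ℝ) ≠ 0 := by exact_mod_cast hN
      simp
      field_simp
      ring
    · rw [sum_cos_add_cos_succ_eq_zero hk0 hk, integral_cos_nat_mul_zero_pi hk0.ne', mul_zero]
  | zero => simp
  | add x y _ _ hx hy =>
    simp only [eval_add]
    rw [intervalIntegral.integral_add (by apply Continuous.intervalIntegrable; fun_prop)
      (by apply Continuous.intervalIntegrable; fun_prop), hx, hy, ← mul_add,
      ← Finset.sum_add_distrib]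
    congr 1
    exact Finset.sum_congr rfl fun j _ => by ring
  | smul a x _ hx =>
    simp only [eval_smul, smul_eq_mul, intervalIntegral.integral_const_mul, hx, ← mul_add,
      ← Finset.mul_sum]
    ring

/-- The coefficient of `U n` in the expansion of `P` in Chebyshev polynomials of the
second kind. -/
noncomputable def chebyshevUCoeff (P : ℝ[X]) (n : ℕ) : ℝ :=
  2 / π * ∫ θ in 0..π, P.eval (cos θ) * (sin ((n + 1) * θ) * sin θ)

theorem chebyshevUCoeff_U (m n : ℕ) :
    chebyshevUCoeff (Chebyshev.U ℝ m) n = if m = n then 1 else 0 := by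
  have h : ∀ θ : ℝ, (Chebyshev.U ℝ m).eval (cos θ) * (sin ((n + 1) * θ) * sin θ) =
      2⁻¹ * (cos (((m : ℤ) - n : ℤ).natAbs * θ) - cos ((m + n + 2 : ℕ) * θ)) := by
    intro θ
    have h1 := Chebyshev.U_real_cos θ m
    have h2 : cos (((m : ℤ) - n : ℤ).natAbs * θ) = cos ((m + 1) * θ - (n + 1) * θ) := by
      rw [← cos_abs ((m + 1) * θ - (n + 1) * θ), ← cos_abs (_ * θ), abs_mul,
        show ((m : ℝ) + 1) * θ - (n + 1) * θ = (m - n) * θ by ring, abs_mul, Nat.cast_natAbs]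
      simp
    have h3 : ((m + n + 2 : ℕ) : ℝ) * θ = (m + 1) * θ + (n + 1) * θ := by push_cast; ring
    rw [h2, h3, cos_add, cos_sub]
    push_cast at h1
    linear_combination sin ((n + 1) * θ) * h1
  unfold chebyshevUCoeff
  simp only [h]
  rw [intervalIntegral.integral_const_mul, intervalIntegral.integral_sub
    (by apply Continuous.intervalIntegrable; fun_prop)
    (by apply Continuous.intervalIntegrable; fun_prop),
    integral_cos_nat_mul_zero_pi (k := m + n + 2) (by omega)]
  split_ifs with hmn
  · subst hmn
    simp
    field_simp
  · rw [integral_cos_nat_mul_zero_pi (by omega)]; simp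

theorem eq_sum_chebyshevUCoeff {P : ℝ[X]} {d : ℕ} (hP : P.natDegree ≤ d) :
    P = ∑ n ∈ Finset.range (d + 1), C (chebyshevUCoeff P n) * Chebyshev.U ℝ n := by
  let V : Polynomial.Sequence ℝ :=
    ⟨fun n => Chebyshev.U ℝ n, fun n => Chebyshev.degree_U_natCast ℝ n⟩
  have hmem : P ∈ degreeLT ℝ (d + 1) := by
    rw [mem_degreeLT]
    exact (degree_le_natDegree).trans_lt (by exact_mod_cast Nat.lt_succ_of_le hP)
  clear hP
  rw [← Sequence.span_degreeLT V fun i _ => by simp [V]] at hmem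
  induction hmem using Submodule.span_induction with
  | mem x h =>
    obtain ⟨k, hk, rfl⟩ := h
    change Chebyshev.U ℝ k = ∑ n ∈ Finset.range (d + 1),
      C (chebyshevUCoeff (Chebyshev.U ℝ k) n) * Chebyshev.U ℝ n
    simp only [chebyshevUCoeff_U]
    rw [Finset.sum_eq_single k (fun n _ hn => by simp [hn.symm]) fun hn =>
      absurd (Finset.mem_range.2 hk) hn]
    simp
  | zero => simp [chebyshevUCoeff]
  | add x y _ _ hx hy =>
    have : ∀ n, chebyshevUCoeff (x + y) n = chebyshevUCoeff x n + chebyshevUCoeff y n := fun n => by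
      simp only [chebyshevUCoeff, eval_add, add_mul]
      rw [intervalIntegral.integral_add (by apply Continuous.intervalIntegrable; fun_prop)
        (by apply Continuous.intervalIntegrable; fun_prop), mul_add]
    simp only [this, C_add, add_mul, Finset.sum_add_distrib]
    rw [← hx, ← hy]
  | smul a x _ hx =>
    have : ∀ n, chebyshevUCoeff (a • x) n = a * chebyshevUCoeff x n := fun n => by
      simp only [chebyshevUCoeff, eval_smul, smul_eq_mul, mul_assoc,
        intervalIntegral.integral_const_mul]
      ring
    simp only [this, C_mul, mul_assoc, ← Finset.mul_sum]
    rw [← hx, smul_eq_C_mul]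

theorem semicircleMeasure_apply_eq_zero {s : Set ℝ} (hs : MeasurableSet s)
    (h : ∀ x ∈ s, 1 ≤ x ^ 2) : semicircleMeasure s = 0 := by
  rw [semicircleMeasure, withDensity_apply _ hs, setLIntegral_congr_fun hs (g := fun _ => 0)]
  · simp
  · intro x hx
    simp [max_eq_right (sub_nonpos.2 (h x hx))]

theorem semicircleMeasure_Ici_cos {t : ℝ} (ht : t ∈ Set.Icc 0 π) :
    (semicircleMeasure (Set.Ici (cos t))).toReal = 2 / π * ∫ θ in 0..t, sin θ ^ 2 := by
  set g : ℝ → ℝ := fun x => (2 / π) * Real.sqrt (max (1 - x ^ 2) 0) with hg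
  have hgc : Continuous g := by fun_prop
  have hg0 : ∀ x, 0 ≤ g x := fun x => by positivity
  have hsplit : semicircleMeasure (Set.Ici (cos t)) = semicircleMeasure (Set.Ioc (cos t) 1) := by
    have hset : Set.Ioc (cos t) 1 ∪ Set.Ioi 1 = Set.Ioi (cos t) :=
      Set.Ioc_union_Ioi_eq_Ioi (cos_le_one t)
    have hIci : semicircleMeasure (Set.Ici (cos t)) = semicircleMeasure (Set.Ioi (cos t)) := by
      have : semicircleMeasure ≪ volume := withDensity_absolutelyContinuous _ _
      exact measure_congr (this.ae_eq Ioi_ae_eq_Ici.symm)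
    rw [hIci, ← hset]
    refine le_antisymm ((measure_union_le _ _).trans ?_) (measure_mono Set.subset_union_left)
    rw [semicircleMeasure_apply_eq_zero measurableSet_Ioi fun x (hx : 1 < x) => by nlinarith,
      add_zero]
  have hint : (semicircleMeasure (Set.Ioc (cos t) 1)).toReal = ∫ x in (cos t)..1, g x := by
    rw [semicircleMeasure, withDensity_apply _ measurableSet_Ioc,
      intervalIntegral.integral_of_le (cos_le_one t),
      integral_eq_lintegral_of_nonneg_ae (Filter.Eventually.of_forall hg0)
        hgc.aestronglyMeasurable]
  have hsub := intervalIntegral.integral_comp_mul_deriv (a := t) (b := 0) (f := cos)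
    (f' := fun x => -sin x) (g := g) (fun x _ => hasDerivAt_cos x) (by fun_prop) hgc
  rw [cos_zero] at hsub
  rw [hsplit, hint, ← hsub, intervalIntegral.integral_symm, ← intervalIntegral.integral_neg,
    ← intervalIntegral.integral_const_mul]
  refine intervalIntegral.integral_congr fun θ hθ => ?_
  rw [Set.uIcc_of_le ht.1] at hθ
  have hs : 0 ≤ sin θ := sin_nonneg_of_mem_Icc ⟨hθ.1, hθ.2.trans ht.2⟩
  have : max (1 - cos θ ^ 2) 0 = sin θ ^ 2 := by
    rw [← sin_sq, max_eq_left (sq_nonneg _)]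
  simp only [hg, Function.comp, this, sqrt_sq hs]
  ring

theorem abs_sin_natCast_mul_le (n : ℕ) (t : ℝ) : |sin (n * t)| ≤ n * |sin t| := by
  induction n with
  | zero => simp
  | succ n ih =>
    rw [Nat.cast_succ, add_mul, one_mul, sin_add, add_mul, one_mul]
    refine (abs_add_le _ _).trans (add_le_add ?_ ?_)
    · rw [abs_mul]
      exact (mul_le_of_le_one_right (abs_nonneg _) (abs_cos_le_one _)).trans ih
    · rw [abs_mul]
      exact mul_le_of_le_one_left (abs_nonneg _) (abs_cos_le_one _)

theorem abs_integral_sin_mul_sin_le {n : ℕ} (hn : 1 ≤ n) (t : ℝ) :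
    |∫ θ in 0..t, sin ((n + 1) * θ) * sin θ| ≤ 2 * |sin t| / n := by
  have hn0 : (0 : ℝ) < n := by exact_mod_cast hn
  have h : ∀ θ : ℝ, sin ((n + 1) * θ) * sin θ =
      2⁻¹ * (cos (n * θ) - cos ((n + 2) * θ)) := fun θ => by
    rw [show (n : ℝ) * θ = (n + 1) * θ - θ by ring,
      show ((n : ℝ) + 2) * θ = (n + 1) * θ + θ by ring, cos_sub, cos_add]
    ring
  have hI : ∫ θ in 0..t, sin ((n + 1) * θ) * sin θ =
      2⁻¹ * (sin (n * t) / n - sin ((n + 2) * t) / (n + 2)) := by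
    simp only [h]
    rw [intervalIntegral.integral_const_mul, intervalIntegral.integral_sub
      (by apply Continuous.intervalIntegrable; fun_prop)
      (by apply Continuous.intervalIntegrable; fun_prop),
      intervalIntegral.integral_comp_mul_left _ hn0.ne',
      intervalIntegral.integral_comp_mul_left _ (by positivity), integral_cos, integral_cos]
    simp
    ring
  have h1 : sin (n * t) / n - sin ((n + 2) * t) / (n + 2) =
      (-2 * (sin t * cos ((n + 1) * t)) + 2 * (sin ((n + 2) * t) / (n + 2))) / n := by
    have : sin (n * t) - sin ((n + 2) * t) = -2 * (sin t * cos ((n + 1) * t)) := by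
      rw [show (n : ℝ) * t = (n + 1) * t - t by ring,
        show ((n : ℝ) + 2) * t = (n + 1) * t + t by ring, sin_sub, sin_add]
      ring
    rw [← this]
    field_simp
    ring
  have h2 : |sin t * cos ((n + 1) * t)| ≤ |sin t| := by
    rw [abs_mul]
    exact mul_le_of_le_one_right (abs_nonneg _) (abs_cos_le_one _)
  have h3 : |sin ((n + 2) * t) / (n + 2)| ≤ |sin t| := by
    rw [abs_div, abs_of_pos (by positivity : (0 : ℝ) < n + 2), div_le_iff₀ (by positivity),
      mul_comm |sin t|]
    exact_mod_cast abs_sin_natCast_mul_le (n + 2) t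
  rw [hI, h1, abs_mul, abs_div, abs_of_pos hn0, abs_of_pos (by norm_num : (0 : ℝ) < 2⁻¹),
    ← mul_div_assoc]
  refine div_le_div_of_nonneg_right ?_ hn0.le
  have := abs_add_le (-2 * (sin t * cos ((n + 1) * t))) (2 * (sin ((n + 2) * t) / (n + 2)))
  rw [abs_mul (-2), abs_mul 2, abs_neg, abs_two] at this
  linarith

theorem abs_integral_mul_sub_integral_le {p q w : ℝ → ℝ} {t b : ℝ} (hp : Continuous p)
    (hq : Continuous q) (hw : Continuous w) (h0 : 0 ≤ t) (htb : t ≤ b)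
    (h₁ : ∀ θ ∈ Set.Icc 0 t, |p θ - 1| ≤ q θ) (h₂ : ∀ θ ∈ Set.Icc t b, |p θ| ≤ q θ) :
    |(∫ θ in 0..b, p θ * w θ) - ∫ θ in 0..t, w θ| ≤ ∫ θ in 0..b, q θ * |w θ| := by
  have hint : ∀ {f : ℝ → ℝ}, Continuous f → ∀ a b, IntervalIntegrable f volume a b :=
    fun hf a b => hf.intervalIntegrable a b
  rw [← intervalIntegral.integral_add_adjacent_intervals (hint (by fun_prop) 0 t)
      (hint (by fun_prop) t b), ← intervalIntegral.integral_add_adjacent_intervals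
      (f := fun θ => q θ * |w θ|) (hint (by fun_prop) 0 t) (hint (by fun_prop) t b),
    add_sub_right_comm, ← intervalIntegral.integral_sub (hint (by fun_prop) 0 t)
      (hint (by fun_prop) 0 t)]
  refine (abs_add_le _ _).trans (add_le_add ?_ ?_)
  · refine (intervalIntegral.abs_integral_le_integral_abs h0).trans
      (intervalIntegral.integral_mono_on h0 (hint (by fun_prop) 0 t) (hint (by fun_prop) 0 t)
        fun θ hθ => ?_)
    rw [← sub_one_mul, abs_mul]
    exact mul_le_mul_of_nonneg_right (h₁ θ hθ) (abs_nonneg _)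
  · refine (intervalIntegral.abs_integral_le_integral_abs htb).trans
      (intervalIntegral.integral_mono_on htb (hint (by fun_prop) t b) (hint (by fun_prop) t b)
        fun θ hθ => ?_)
    rw [abs_mul]
    exact mul_le_mul_of_nonneg_right (h₂ θ hθ) (abs_nonneg _)

/-- Markov–Stieltjes majorant `P` and minorant `M` of the Heaviside function at the `k`-th zero
of `U (N - 1)`. -/
theorem exists_majorant_minorant_at_node {N k : ℕ} (hk : 0 < k) (hkN : k < N) :
    ∃ P M : ℝ[X], P.natDegree ≤ 2 * (N - 2) ∧ M.natDegree ≤ 2 * (N - 2) ∧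
      (∀ x ≤ cos (k * π / N), 0 ≤ P.eval x ∧ M.eval x ≤ 0) ∧
      (∀ x, cos (k * π / N) ≤ x → 1 ≤ P.eval x ∧ M.eval x ≤ 1) ∧
      (∫ θ in 0..π, (P - M).eval (cos θ) ≤ 3 * π / N) ∧
      ∫ θ in 0..π, (P - M).eval (cos θ) * sin θ ^ 2 = π / N * sin (k * π / N) ^ 2 := by
  obtain ⟨m, rfl⟩ : ∃ m, N = m + 1 := ⟨N - 1, by omega⟩
  set N := m + 1 with hNdef
  have hN : (0 : ℝ) < N := by positivity
  have hNm : (N : ℝ) = m + 1 := by simp [hNdef]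
  set ξ := cos (k * π / N) with hξ
  have hsin : ∀ j : ℕ, 0 < j → j < N → 0 < sin (j * π / N) := fun j hj hjN => by
    have hj' : (0 : ℝ) < j := by exact_mod_cast hj
    apply sin_pos_of_pos_of_lt_pi (by positivity)
    rw [div_lt_iff₀ hN, mul_comm]
    exact mul_lt_mul_of_pos_left (by exact_mod_cast hjN) pi_pos
  have hUnode : ∀ j : ℕ, 0 < j → j < N → (Chebyshev.U ℝ m).eval (cos (j * π / N)) = 0 := by
    intro j hj hjN
    have h1 := Chebyshev.U_real_cos (j * π / N) m
    have h2 : (((m : ℤ) : ℝ) + 1) * (j * π / N) = j * π := by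
      rw [Int.cast_natCast, ← hNm]; field_simp
    rw [h2, sin_nat_mul_pi] at h1
    exact (mul_eq_zero.1 h1).resolve_right (hsin j hj hjN).ne'
  have hs := hsin k hk hkN
  set Z : Finset ℝ := (Finset.range m).image fun j : ℕ => cos ((j + 1) * π / (m + 1)) with hZ
  have hroots : (Chebyshev.U ℝ m).roots = Z.val := Chebyshev.roots_U_real m
  have hξZ : ξ ∈ Z := by
    rw [← Finset.mem_val, ← hroots, mem_roots (Chebyshev.U_ne_zero ℝ m (by omega))]
    exact hUnode k hk hkN
  have hcard : Z.card = m := by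
    rw [hZ, Finset.card_image_of_injOn
      ((Finset.range m).nodup_map_iff_injOn.1 (Chebyshev.roots_U_real_nodup m)),
      Finset.card_range]
  have hUprod : Chebyshev.U ℝ m = C (2 ^ m) * ∏ a ∈ Z, (X - C a) := by
    have := C_leadingCoeff_mul_prod_multiset_X_sub_C (p := Chebyshev.U ℝ m)
      (by rw [hroots, Finset.card_val, hcard, Chebyshev.natDegree_U_natCast])
    rw [hroots, Chebyshev.leadingCoeff_U_natCast] at this
    exact this.symm
  set l := Z.filter (· < ξ) with hl
  set r := Z.filter (ξ < ·) with hr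
  have hdisj : Disjoint l r := Finset.disjoint_filter.2 fun x _ h1 h2 => lt_asymm h1 h2
  have hunion : Z.erase ξ = l ∪ r := by
    ext x
    simp only [hl, hr, Finset.mem_erase, Finset.mem_union, Finset.mem_filter, ← and_or_left,
      ← ne_iff_lt_or_gt]
    tauto
  have hlr : l.card + r.card = N - 2 := by
    rw [← Finset.card_union_of_disjoint hdisj, ← hunion, Finset.card_erase_of_mem hξZ, hcard]
    omega
  obtain ⟨P, M, c, hPd, hMd, hle, hge, hQ, hQξ⟩ := exists_markov_stieltjes l r ξ
    (fun a ha => (Finset.mem_filter.1 ha).2) fun b hb => (Finset.mem_filter.1 hb).2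
  set q : ℝ[X] := (∏ a ∈ l, (X - C a)) * ∏ b ∈ r, (X - C b) with hq
  have hUq : Chebyshev.U ℝ m = C (2 ^ m) * ((X - C ξ) * q) := by
    rw [hUprod, ← Finset.mul_prod_erase Z _ hξZ, hunion, Finset.prod_union hdisj]
  rw [hlr] at hPd hMd
  have hUeval : ∀ x, (Chebyshev.U ℝ m).eval x = 2 ^ m * ((x - ξ) * q.eval x) := fun x => by
    rw [hUq]; simp only [eval_mul, eval_C, eval_sub, eval_X]
  have hξ1 : ξ ^ 2 = 1 - sin (k * π / N) ^ 2 := by rw [hξ, cos_sq']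
  have hQnode : ∀ j : ℕ, 0 < j → j < N → j ≠ k → (P - M).eval (cos (j * π / N)) = 0 := by
    intro j hj hjN hjk
    have h1 := hUnode j hj hjN
    have h2 : cos (j * π / N) - ξ ≠ 0 := by
      refine sub_ne_zero.2 fun h => hjk ?_
      have hmem : ∀ i : ℕ, i < N → (i * π / N : ℝ) ∈ Set.Icc 0 π := fun i hi => by
        refine ⟨by positivity, ?_⟩
        rw [div_le_iff₀ hN, mul_comm]
        exact mul_le_mul_of_nonneg_left (by exact_mod_cast hi.le) pi_pos.le
      have h3 := injOn_cos (hmem j hjN) (hmem k hkN) h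
      have h4 : (j : ℝ) = k := by
        have := pi_pos.ne'
        field_simp at h3
        exact h3
      exact_mod_cast h4
    rw [hUeval] at h1
    have h3 : q.eval (cos (j * π / N)) = 0 := by
      rcases mul_eq_zero.1 h1 with h | h
      · exact absurd h (by positivity)
      · exact (mul_eq_zero.1 h).resolve_left h2
    rw [hQ, eval_mul, eval_pow, h3]; simp
  have hcos_k : (cos (k * π)) ^ 2 = 1 := by
    rw [cos_sq', sin_nat_mul_pi]; simp
  have hqξ : (2 ^ m * q.eval ξ * sin (k * π / N) ^ 2) ^ 2 = N ^ 2 := by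
    have h1 := congrArg (eval ξ) (Chebyshev.add_one_mul_T_eq_poly_in_U (R := ℝ) m)
    have hT : (Chebyshev.T ℝ ((m : ℤ) + 1)).eval ξ = cos (k * π) := by
      rw [hξ, Chebyshev.T_real_cos]
      congr 1
      push_cast
      rw [← hNm]; field_simp
    have hder : (derivative (Chebyshev.U ℝ m)).eval ξ = 2 ^ m * q.eval ξ := by
      rw [hUq, derivative_C_mul, derivative_mul]
      simp
    simp only [eval_mul, eval_sub, eval_add, eval_one, eval_X, eval_pow, hT, hder, hUeval,
      sub_self, zero_mul, mul_zero, zero_sub, hξ1, sub_sub_cancel] at h1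
    simp only [Int.cast_natCast, eval_natCast, ← hNm] at h1
    calc _ = (N * cos (k * π)) ^ 2 := by rw [h1]; ring
      _ = N ^ 2 := by rw [mul_pow, hcos_k, mul_one]
  have hc : c * (q.eval ξ) ^ 2 = 1 := by
    rw [hQ, eval_mul, eval_C, eval_pow] at hQξ
    exact hQξ
  have hQend : ∀ x : ℝ, (2 ^ m * ((x - ξ) * q.eval x)) ^ 2 = N ^ 2 →
      (x - ξ) ^ 2 * (P - M).eval x = sin (k * π / N) ^ 4 := by
    intro x hx
    rw [hQ, eval_mul, eval_C, eval_pow]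
    have h1 : (2 ^ m * q.eval ξ) ^ 2 ≠ 0 := by
      intro h
      rw [mul_pow, h, zero_mul] at hqξ
      exact (pow_pos hN 2).ne hqξ
    apply mul_left_cancel₀ h1
    linear_combination (2 ^ m * ((x - ξ) * eval x q)) ^ 2 * hc + hx - hqξ
  have hQ1 : (P - M).eval 1 = (1 + ξ) ^ 2 := by
    have h1 := hQend 1 (by rw [← hUeval, Chebyshev.U_eval_one, hNm]; simp)
    have h2 : sin (k * π / N) ^ 4 = (1 - ξ) ^ 2 * (1 + ξ) ^ 2 := by
      rw [show sin (k * π / N) ^ 4 = (1 - ξ ^ 2) ^ 2 by rw [hξ1]; ring]; ring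
    rw [h2] at h1
    refine mul_left_cancel₀ (pow_ne_zero 2 fun h => ?_) h1
    have : (1 + ξ) * (1 - ξ) = sin (k * π / N) ^ 2 := by linear_combination -hξ1
    rw [h, mul_zero] at this
    exact (pow_pos hs 2).ne this
  have hQm1 : (P - M).eval (-1) = (1 - ξ) ^ 2 := by
    have h1 := hQend (-1) (by
      rw [← hUeval, Chebyshev.U_eval_neg_one, hNm, mul_pow, ← Int.cast_pow]
      simp [← Units.val_pow_eq_pow_val])
    have h2 : sin (k * π / N) ^ 4 = (-1 - ξ) ^ 2 * (1 - ξ) ^ 2 := by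
      rw [show sin (k * π / N) ^ 4 = (1 - ξ ^ 2) ^ 2 by rw [hξ1]; ring]; ring
    rw [h2] at h1
    refine mul_left_cancel₀ (pow_ne_zero 2 fun h => ?_) h1
    have : (-1 - ξ) * (ξ - 1) = sin (k * π / N) ^ 2 := by linear_combination -hξ1
    rw [h, zero_mul] at this
    exact (pow_pos hs 2).ne this
  have hQd : (P - M).natDegree ≤ 2 * (N - 2) := (natDegree_sub_le_of_le hPd hMd).trans (by simp)
  have htrap : ∀ f : ℝ[X], f.natDegree < 2 * N →
      (∀ j : ℕ, 0 < j → j < N → j ≠ k → f.eval (cos (j * π / N)) = 0) →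
      ∫ θ in 0..π, f.eval (cos θ) = π / N * (f.eval ξ + (f.eval 1 + f.eval (-1)) / 2) := by
    intro f hf hf0
    rw [integral_eval_cos_eq_trapezoid hf, Finset.sum_add_distrib]
    have h0 : f.eval (cos ((0 : ℕ) * π / N)) = f.eval 1 := by simp
    have hNN : f.eval (cos ((N : ℕ) * π / N)) = f.eval (-1) := by
      rw [mul_div_cancel_left₀ _ hN.ne', cos_pi]
    have hsum : ∑ j ∈ Finset.range N, f.eval (cos (j * π / N)) = f.eval 1 + f.eval ξ := by
      rw [Finset.sum_eq_add 0 k hk.ne (fun j hj hjk => hf0 j (by omega)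
        (Finset.mem_range.1 hj) hjk.2) (fun h => absurd (Finset.mem_range.2 (by omega)) h)
        (fun h => absurd (Finset.mem_range.2 hkN) h), h0]
    have hshift := Finset.sum_range_succ (fun j : ℕ => f.eval (cos (j * π / N))) N
    rw [Finset.sum_range_succ', h0, hNN, hsum] at hshift
    rw [hsum, show ∑ j ∈ Finset.range N, f.eval (cos ((j + 1 : ℕ) * π / N)) =
      f.eval ξ + f.eval (-1) by linarith]
    field_simp
    ring
  refine ⟨P, M, hPd, hMd, hle, hge, ?_, ?_⟩
  · rw [htrap _ (by omega) hQnode, hQξ, hQ1, hQm1]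
    rw [show 3 * π / N = π / N * 3 by ring]
    refine mul_le_mul_of_nonneg_left ?_ (by positivity)
    nlinarith [sq_nonneg (sin (k * π / N))]
  · have h1 := htrap ((P - M) * (1 - X ^ 2)) (by
      have h2 : (1 - X ^ 2 : ℝ[X]).natDegree ≤ 2 := by compute_degree
      have := natDegree_mul_le (p := P - M) (q := 1 - X ^ 2)
      omega) (fun j hj hjN hjk => by rw [eval_mul, hQnode j hj hjN hjk, zero_mul])
    simp only [eval_mul, eval_sub (1 : ℝ[X]), eval_one, eval_pow, eval_X, hQξ, hξ1] at h1
    simp only [← sin_sq] at h1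
    rw [h1]
    ring

theorem abs_chebyshevUCoeff_zero_sub_le {R Q : ℝ[X]} {t : ℝ} (ht : t ∈ Set.Icc 0 π)
    (h₁ : ∀ x, cos t ≤ x → |R.eval x - 1| ≤ Q.eval x)
    (h₂ : ∀ x ≤ cos t, |R.eval x| ≤ Q.eval x) :
    |chebyshevUCoeff R 0 - 2 / π * ∫ θ in 0..t, sin θ ^ 2| ≤
      2 / π * ∫ θ in 0..π, Q.eval (cos θ) * sin θ ^ 2 := by
  have h := abs_integral_mul_sub_integral_le (p := fun θ => R.eval (cos θ))
    (q := fun θ => Q.eval (cos θ)) (w := fun θ => sin θ ^ 2) (by fun_prop) (by fun_prop)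
    (by fun_prop) ht.1 ht.2
    (fun θ hθ => h₁ _ (cos_le_cos_of_nonneg_of_le_pi hθ.1 ht.2 hθ.2))
    (fun θ hθ => h₂ _ (cos_le_cos_of_nonneg_of_le_pi ht.1 hθ.2 hθ.1))
  have e : chebyshevUCoeff R 0 = 2 / π * ∫ θ in 0..π, R.eval (cos θ) * sin θ ^ 2 := by
    simp [chebyshevUCoeff, sq]
  simp only [abs_pow, sq_abs] at h
  rw [e, ← mul_sub, abs_mul, abs_of_nonneg (by positivity)]
  gcongr

theorem abs_chebyshevUCoeff_le {R Q : ℝ[X]} {t : ℝ} (ht : t ∈ Set.Ioo 0 π)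
    (h₁ : ∀ x, cos t ≤ x → |R.eval x - 1| ≤ Q.eval x)
    (h₂ : ∀ x ≤ cos t, |R.eval x| ≤ Q.eval x) {n : ℕ} (hn : 1 ≤ n) :
    |chebyshevUCoeff R n| ≤ 2 / π * (2 * sin t / n +
      ((∫ θ in 0..π, Q.eval (cos θ) * sin θ ^ 2) / sin t +
        sin t * ∫ θ in 0..π, Q.eval (cos θ)) / 2) := by
  have hs := sin_pos_of_mem_Ioo ht
  have h := abs_integral_mul_sub_integral_le (p := fun θ => R.eval (cos θ))
    (q := fun θ => Q.eval (cos θ)) (w := fun θ => sin ((n + 1) * θ) * sin θ) (by fun_prop)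
    (by fun_prop) (by fun_prop) ht.1.le ht.2.le
    (fun θ hθ => h₁ _ (cos_le_cos_of_nonneg_of_le_pi hθ.1 ht.2.le hθ.2))
    (fun θ hθ => h₂ _ (cos_le_cos_of_nonneg_of_le_pi ht.1.le hθ.2 hθ.1))
  have hw := abs_integral_sin_mul_sin_le hn t
  rw [abs_of_pos hs] at hw
  have hQ : ∫ θ in 0..π, Q.eval (cos θ) * |sin ((n + 1) * θ) * sin θ| ≤
      ((∫ θ in 0..π, Q.eval (cos θ) * sin θ ^ 2) / sin t +
        sin t * ∫ θ in 0..π, Q.eval (cos θ)) / 2 := by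
    rw [← intervalIntegral.integral_div, ← intervalIntegral.integral_const_mul,
      ← intervalIntegral.integral_add, ← intervalIntegral.integral_div]
    · refine intervalIntegral.integral_mono_on pi_pos.le
        (Continuous.intervalIntegrable (by fun_prop) _ _)
        (Continuous.intervalIntegrable (by fun_prop) _ _) fun θ hθ => ?_
      have hQ0 : 0 ≤ Q.eval (cos θ) := by
        rcases le_total (cos t) (cos θ) with h | h
        · exact (abs_nonneg _).trans (h₁ _ h)
        · exact (abs_nonneg _).trans (h₂ _ h)
      have hsin : |sin ((n + 1) * θ) * sin θ| ≤ sin θ := by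
        rw [abs_mul, abs_of_nonneg (sin_nonneg_of_mem_Icc hθ)]
        exact mul_le_of_le_one_left (sin_nonneg_of_mem_Icc hθ) (abs_sin_le_one _)
      have hamgm : sin θ ≤ (sin θ ^ 2 / sin t + sin t) / 2 := by
        rw [le_div_iff₀ two_pos, ← sub_nonneg]
        have : sin θ ^ 2 / sin t + sin t - sin θ * 2 = (sin θ - sin t) ^ 2 / sin t := by
          field_simp
          ring
        rw [this]
        positivity
      calc _ ≤ Q.eval (cos θ) * ((sin θ ^ 2 / sin t + sin t) / 2) := by
            gcongr
            exact hsin.trans hamgm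
        _ = _ := by ring
    · exact Continuous.intervalIntegrable (by fun_prop) _ _
    · exact Continuous.intervalIntegrable (by fun_prop) _ _
  rw [chebyshevUCoeff, abs_mul, abs_of_nonneg (by positivity)]
  gcongr
  have := abs_sub_abs_le_abs_sub (∫ θ in 0..π, R.eval (cos θ) * (sin ((n + 1) * θ) * sin θ))
    (∫ θ in 0..t, sin ((n + 1) * θ) * sin θ)
  linarith

theorem integrable_eval_of_chebyshevU {μ : Measure ℝ}
    (hμ : ∀ n : ℕ, Integrable (fun x => (Chebyshev.U ℝ n).eval x) μ) (R : ℝ[X]) :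
    Integrable (fun x => R.eval x) μ := by
  rw [eq_sum_chebyshevUCoeff (P := R) le_rfl]
  simp only [eval_finsetSum, eval_mul, eval_C]
  exact integrable_finsetSum _ fun n _ => (hμ n).const_mul _

theorem abs_integral_eval_sub_chebyshevUCoeff_zero_le {μ : Measure ℝ} [IsProbabilityMeasure μ]
    (hμ : ∀ n : ℕ, Integrable (fun x => (Chebyshev.U ℝ n).eval x) μ) {R : ℝ[X]} {d : ℕ}
    (hR : R.natDegree ≤ d) :
    |(∫ x, R.eval x ∂μ) - chebyshevUCoeff R 0| ≤
      ∑ n ∈ Finset.Icc 1 d, |chebyshevUCoeff R n| * |∫ x, (Chebyshev.U ℝ n).eval x ∂μ| := by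
  have h : ∫ x, R.eval x ∂μ = ∑ n ∈ Finset.range (d + 1),
      chebyshevUCoeff R n * ∫ x, (Chebyshev.U ℝ n).eval x ∂μ := by
    conv_lhs => rw [eq_sum_chebyshevUCoeff hR]
    simp only [eval_finsetSum, eval_mul, eval_C]
    rw [integral_finsetSum _ fun n _ => (hμ n).const_mul _]
    simp only [integral_const_mul]
  rw [h, Finset.range_eq_Ico, Finset.sum_eq_sum_Ico_succ_bot (by omega)]
  simp only [Nat.cast_zero, Chebyshev.U_zero, eval_one, integral_const, probReal_univ, smul_eq_mul,
    mul_one, add_sub_cancel_left, zero_add]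
  rw [Finset.Ico_add_one_right_eq_Icc]
  exact (Finset.abs_sum_le_sum_abs _ _).trans_eq (by simp only [abs_mul])

/-- The inequality at the zeros of `U (N - 1)`. -/
theorem measure_node_bounds {μ : Measure ℝ} [IsProbabilityMeasure μ]
    (hμ : ∀ n : ℕ, Integrable (fun x => (Chebyshev.U ℝ n).eval x) μ) {d N k : ℕ}
    (hdN : d ≤ 2 * N) (hNd : 2 * (N - 2) ≤ d) (hk : 0 < k) (hkN : k < N) :
    (μ (Set.Ici (cos (k * π / N)))).toReal ≤
        2 / π * (∫ θ in 0..k * π / N, sin θ ^ 2) + (2 * sin (k * π / N) ^ 2 / N +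
          10 * sin (k * π / N) *
            ∑ n ∈ Finset.Icc 1 d, (n : ℝ)⁻¹ * |∫ x, (Chebyshev.U ℝ n).eval x ∂μ|) ∧
      2 / π * (∫ θ in 0..k * π / N, sin θ ^ 2) - (2 * sin (k * π / N) ^ 2 / N +
          10 * sin (k * π / N) *
            ∑ n ∈ Finset.Icc 1 d, (n : ℝ)⁻¹ * |∫ x, (Chebyshev.U ℝ n).eval x ∂μ|) ≤
        (μ (Set.Ici (cos (k * π / N)))).toReal := by
  obtain ⟨P, M, hP, hM, hle, hge, hQ, hQs⟩ := exists_majorant_minorant_at_node hk hkN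
  have hN : (0 : ℝ) < N := by exact_mod_cast hk.trans hkN
  have ht : k * π / N ∈ Set.Ioo 0 π := by
    refine ⟨by positivity, ?_⟩
    rw [div_lt_iff₀ hN, mul_comm π]
    gcongr
  set t := k * π / N with ht_def
  have hs := sin_pos_of_mem_Ioo ht
  have key : ∀ R : ℝ[X], R.natDegree ≤ 2 * (N - 2) →
      (∀ x, cos t ≤ x → |R.eval x - 1| ≤ (P - M).eval x) →
      (∀ x ≤ cos t, |R.eval x| ≤ (P - M).eval x) →
      |(∫ x, R.eval x ∂μ) - 2 / π * ∫ θ in 0..t, sin θ ^ 2| ≤ 2 * sin t ^ 2 / N +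
        10 * sin t * ∑ n ∈ Finset.Icc 1 d, (n : ℝ)⁻¹ * |∫ x, (Chebyshev.U ℝ n).eval x ∂μ| := by
    intro R hR h₁ h₂
    have h0 := abs_chebyshevUCoeff_zero_sub_le ⟨ht.1.le, ht.2.le⟩ h₁ h₂
    have hint := abs_integral_eval_sub_chebyshevUCoeff_zero_le hμ (hR.trans hNd)
    have hc : ∀ n ∈ Finset.Icc 1 d, |chebyshevUCoeff R n| ≤ 10 * sin t * (n : ℝ)⁻¹ := by
      intro n hn
      rw [Finset.mem_Icc] at hn
      have hn0 : (0 : ℝ) < n := by exact_mod_cast hn.1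
      have hnN : (n : ℝ) ≤ 2 * N := by exact_mod_cast hn.2.trans hdN
      calc _ ≤ _ := abs_chebyshevUCoeff_le ht h₁ h₂ hn.1
        _ ≤ 2 / π * (2 * sin t / n + ((π / N * sin t ^ 2) / sin t + sin t * (3 * π / N)) / 2) := by
          rw [hQs]
          gcongr
        _ = sin t * (4 * π⁻¹ * (n : ℝ)⁻¹ + 4 * (N : ℝ)⁻¹) := by
          field_simp
          ring
        _ ≤ sin t * (4 * 2⁻¹ * (n : ℝ)⁻¹ + 4 * (2 * (n : ℝ)⁻¹)) := by
          gcongr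
          · exact two_le_pi
          · rw [← div_eq_mul_inv, inv_le_comm₀ hN (by positivity), inv_div]
            linarith
        _ = _ := by ring
    have hsum : ∑ n ∈ Finset.Icc 1 d,
          |chebyshevUCoeff R n| * |∫ x, (Chebyshev.U ℝ n).eval x ∂μ| ≤
        10 * sin t * ∑ n ∈ Finset.Icc 1 d, (n : ℝ)⁻¹ * |∫ x, (Chebyshev.U ℝ n).eval x ∂μ| := by
      rw [Finset.mul_sum]
      refine Finset.sum_le_sum fun n hn => ?_
      rw [← mul_assoc]
      gcongr
      exact hc n hn
    rw [hQs] at h0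
    have e : 2 / π * (π / N * sin t ^ 2) = 2 * sin t ^ 2 / N := by field_simp
    rw [e] at h0
    calc _ ≤ _ := abs_sub_le _ (chebyshevUCoeff R 0) _
      _ ≤ _ := by linarith
  have hPb := abs_le.1 (key P hP
    (fun x hx => by
      have := hge x hx
      rw [eval_sub, abs_of_nonneg] <;> linarith)
    (fun x hx => by
      have := hle x hx
      rw [eval_sub, abs_of_nonneg] <;> linarith))
  have hMb := abs_le.1 (key M hM
    (fun x hx => by
      have := hge x hx
      rw [eval_sub, abs_of_nonpos] <;> linarith)
    (fun x hx => by
      have := hle x hx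
      rw [eval_sub, abs_of_nonpos] <;> linarith))
  have hind : ∫ x, (Set.Ici (cos t)).indicator 1 x ∂μ = (μ (Set.Ici (cos t))).toReal :=
    integral_indicator_one measurableSet_Ici
  have hindi : Integrable ((Set.Ici (cos t)).indicator (1 : ℝ → ℝ)) μ :=
    (integrable_const (1 : ℝ)).indicator measurableSet_Ici
  have hup : (μ (Set.Ici (cos t))).toReal ≤ ∫ x, P.eval x ∂μ := by
    rw [← hind]
    refine integral_mono hindi (integrable_eval_of_chebyshevU hμ P) fun x => ?_
    by_cases hx : cos t ≤ x
    · simpa [hx] using (hge x hx).1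
    · simpa [hx] using (hle x (not_le.1 hx).le).1
  have hlow : ∫ x, M.eval x ∂μ ≤ (μ (Set.Ici (cos t))).toReal := by
    rw [← hind]
    refine integral_mono (integrable_eval_of_chebyshevU hμ M) hindi fun x => ?_
    by_cases hx : cos t ≤ x
    · simpa [hx] using (hge x hx).2
    · simpa [hx] using (hle x (not_le.1 hx).le).2
  constructor <;> linarith

theorem integral_sin_sq_sub_le {θ a b δ r : ℝ} (hab : a ≤ b) (haθ : θ - δ ≤ a)
    (hbθ : b ≤ θ + δ) (hba : b - a ≤ δ) (hr : |sin θ| + δ ≤ r) :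
    2 / π * (∫ x in 0..b, sin x ^ 2) - 2 / π * (∫ x in 0..a, sin x ^ 2) ≤ 2 / π * (δ * r ^ 2) := by
  rw [← mul_sub, intervalIntegral.integral_interval_sub_left
    (Continuous.intervalIntegrable (by fun_prop) _ _)
    (Continuous.intervalIntegrable (by fun_prop) _ _)]
  gcongr
  calc ∫ x in a..b, sin x ^ 2 ≤ ∫ _ in a..b, r ^ 2 := by
        refine intervalIntegral.integral_mono_on hab
          (Continuous.intervalIntegrable (by fun_prop) _ _)
          (Continuous.intervalIntegrable (by fun_prop) _ _) fun x hx => ?_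
        have h := abs_sin_sub_sin_le x θ
        have h' : |x - θ| ≤ δ := abs_le.2 ⟨by linarith [hx.1], by linarith [hx.2]⟩
        have := abs_sub_abs_le_abs_sub (sin x) (sin θ)
        exact sq_le_sq' (by linarith [neg_abs_le (sin x)]) (by linarith [le_abs_self (sin x)])
    _ = (b - a) * r ^ 2 := by simp
    _ ≤ δ * r ^ 2 := by gcongr

theorem abs_measure_Ici_cos_sub_le {μ : Measure ℝ} [IsProbabilityMeasure μ]
    (hμ : ∀ n : ℕ, Integrable (fun x => (Chebyshev.U ℝ n).eval x) μ) {d : ℕ} (hd : 1 ≤ d)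
    {θ r : ℝ} (hθ : θ ∈ Set.Icc 0 π) (hθr : sin θ ≤ 3 / 2 * r) (hdr : (d : ℝ)⁻¹ ≤ r) :
    |(μ (Set.Ici (cos θ))).toReal - (semicircleMeasure (Set.Ici (cos θ))).toReal| ≤
      512 * (r ^ 2 / d + r *
        ∑ n ∈ Finset.Icc 1 d, (n : ℝ)⁻¹ * |∫ x, (Chebyshev.U ℝ n).eval x ∂μ|) := by
  set S := ∑ n ∈ Finset.Icc 1 d, (n : ℝ)⁻¹ * |∫ x, (Chebyshev.U ℝ n).eval x ∂μ| with hS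
  have hS0 : 0 ≤ S := Finset.sum_nonneg fun n _ => by positivity
  have hd0 : (0 : ℝ) < d := by exact_mod_cast hd
  have hr : 0 < r := (inv_pos.2 hd0).trans_le hdr
  obtain ⟨N, hN2, hdN, hNd⟩ : ∃ N : ℕ, 0 < N ∧ d ≤ 2 * N ∧ 2 * (N - 2) ≤ d :=
    ⟨d / 2 + 2, by omega, by omega, by omega⟩
  have hN : (0 : ℝ) < N := by exact_mod_cast hN2
  have hNinv : (N : ℝ)⁻¹ ≤ 2 * (d : ℝ)⁻¹ := by
    rw [← div_eq_mul_inv, inv_le_comm₀ hN (by positivity), inv_div, div_le_iff₀ two_pos]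
    exact_mod_cast hdN.trans_eq (mul_comm _ _)
  have hδ : π / N ≤ 32 / 5 * r := by
    calc π / N = π * (N : ℝ)⁻¹ := div_eq_mul_inv _ _
      _ ≤ 3.2 * (2 * r) := by
        gcongr
        · linarith [pi_lt_d2]
        · linarith
      _ = _ := by ring
  have hsin : |sin θ| + π / N ≤ 8 * r := by
    rw [abs_of_nonneg (sin_nonneg_of_mem_Icc hθ)]
    linarith
  have hcell : 2 / π * (π / N * (8 * r) ^ 2) = 128 * r ^ 2 * (N : ℝ)⁻¹ := by
    field_simp
    ring
  have hdiff : ∀ {a b}, a ≤ b → θ - π / N ≤ a → b ≤ θ + π / N → b - a ≤ π / N →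
      2 / π * (∫ x in 0..b, sin x ^ 2) - 2 / π * (∫ x in 0..a, sin x ^ 2) ≤
        128 * r ^ 2 * (N : ℝ)⁻¹ := fun h₁ h₂ h₃ h₄ =>
    (integral_sin_sq_sub_le h₁ h₂ h₃ h₄ hsin).trans_eq hcell
  have hnode : ∀ t, t ∈ Set.Icc 0 π → |t - θ| ≤ π / N →
      2 * sin t ^ 2 / N + 10 * sin t * S ≤ 128 * r ^ 2 * (N : ℝ)⁻¹ + 80 * r * S := by
    intro t ht htθ
    have h0 := sin_nonneg_of_mem_Icc ht
    have h : sin t ≤ 8 * r := by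
      linarith [abs_sin_sub_sin_le t θ, le_abs_self (sin t - sin θ), le_abs_self (sin θ)]
    calc _ ≤ 2 * (8 * r) ^ 2 / N + 10 * (8 * r) * S := by gcongr
      _ = _ := by ring
  have hfin : 128 * r ^ 2 * (N : ℝ)⁻¹ + (128 * r ^ 2 * (N : ℝ)⁻¹ + 80 * r * S) ≤
      512 * (r ^ 2 / d + r * S) := by
    have h₁ : 256 * r ^ 2 * (N : ℝ)⁻¹ ≤ 256 * r ^ 2 * (2 * (d : ℝ)⁻¹) := by gcongr
    have h₂ : 0 ≤ r * S := by positivity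
    rw [div_eq_mul_inv]
    linarith
  have hpos : 0 ≤ 80 * r * S := by positivity
  have hpos' : 0 ≤ 128 * r ^ 2 * (N : ℝ)⁻¹ := by positivity
  have hx : θ * N / π * (π / N) = θ := by field_simp
  have hπN : (0 : ℝ) < π / N := by positivity
  have hNπ : (N : ℝ) * (π / N) = π := by field_simp
  have htot : 2 / π * ∫ x in 0..π, sin x ^ 2 = 1 := by
    rw [integral_sin_sq]
    simp
  have hmono : ∀ {x y : ℝ}, x ≤ y → (μ (Set.Ici y)).toReal ≤ (μ (Set.Ici x)).toReal :=
    fun h => measureReal_mono (Set.Ici_subset_Ici.2 h)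
  rw [semicircleMeasure_Ici_cos hθ, abs_sub_le_iff]
  constructor
  · have h₁ := mul_le_mul_of_nonneg_right (Nat.lt_floor_add_one (θ * N / π)).le hπN.le
    have h₂ := mul_le_mul_of_nonneg_right (Nat.floor_le (a := θ * N / π)
      (by have := hθ.1; positivity)) hπN.le
    set k := ⌊θ * N / π⌋₊ + 1 with hk
    have hkc : (k : ℝ) = ⌊θ * N / π⌋₊ + 1 := by simp [hk]
    rw [← hkc, hx] at h₁
    rw [hx, ← sub_eq_iff_eq_add.2 hkc, sub_mul, one_mul] at h₂
    rcases lt_or_ge k N with hkN | hkN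
    · have hb := (measure_node_bounds hμ hdN hNd (Nat.succ_pos _) hkN).1
      have hkN' : (k : ℝ) * (π / N) ≤ π :=
        (mul_le_mul_of_nonneg_right (by exact_mod_cast hkN.le) hπN.le).trans_eq hNπ
      rw [← hS, mul_div_assoc] at hb
      have := hnode _ ⟨hθ.1.trans h₁, hkN'⟩ (abs_le.2 ⟨by linarith, by linarith⟩)
      have := hdiff h₁ (by linarith) (by linarith) (by linarith)
      have := hmono (cos_le_cos_of_nonneg_of_le_pi hθ.1 hkN' h₁)
      linarith
    · have hkN' : π ≤ k * (π / N) :=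
        hNπ.symm.trans_le (mul_le_mul_of_nonneg_right (by exact_mod_cast hkN) hπN.le)
      have := hdiff hθ.2 (by linarith) (by linarith) (by linarith)
      have : (μ (Set.Ici (cos θ))).toReal ≤ 1 := measureReal_le_one
      linarith
  · rcases Nat.eq_zero_or_pos (⌈θ * N / π⌉₊ - 1) with hk0 | hk0
    · have h₁ : θ * N / π ≤ 1 := (Nat.le_ceil _).trans (by
        exact_mod_cast (by omega : ⌈θ * N / π⌉₊ ≤ 1))
      have h₂ := mul_le_mul_of_nonneg_right h₁ hπN.le
      rw [hx] at h₂
      have := hdiff hθ.1 (by linarith) (by linarith) (by linarith)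
      rw [intervalIntegral.integral_same] at this
      have : 0 ≤ (μ (Set.Ici (cos θ))).toReal := ENNReal.toReal_nonneg
      linarith
    · have h₁ := mul_le_mul_of_nonneg_right (Nat.le_ceil (θ * N / π)) hπN.le
      have h₂ := mul_le_mul_of_nonneg_right (Nat.ceil_lt_add_one (a := θ * N / π)
        (by have := hθ.1; positivity)).le hπN.le
      have hceil : ⌈θ * N / π⌉₊ ≤ N := by
        rw [Nat.ceil_le, div_le_iff₀ pi_pos, mul_comm (N : ℝ)]
        exact mul_le_mul_of_nonneg_right hθ.2 hN.le
      set k := ⌈θ * N / π⌉₊ - 1 with hk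
      have hkc : (⌈θ * N / π⌉₊ : ℝ) = k + 1 := by
        exact_mod_cast (by omega : ⌈θ * N / π⌉₊ = k + 1)
      rw [hx, hkc] at h₁
      rw [hkc, add_mul, add_mul, hx] at h₂
      have hb := (measure_node_bounds hμ hdN hNd hk0 (by omega : k < N)).2
      rw [← hS, mul_div_assoc] at hb
      have hkθ : k * (π / N) ≤ θ := by linarith
      have hk' : 0 ≤ k * (π / N) := by positivity
      have := hnode _ ⟨hk', hkθ.trans hθ.2⟩ (abs_le.2 ⟨by linarith, by linarith⟩)
      have := hdiff hkθ (by linarith) (by linarith) (by linarith)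
      have := hmono (cos_le_cos_of_nonneg_of_le_pi hk' hθ.2 hkθ)
      linarith

/-- **Weighted Erdős–Turán-type inequality for the semicircle law.** There is a
universal constant `K > 0` such that for any probability measure `μ` on `ℝ`
(whose Chebyshev moments exist), any `n₀ ≥ 1` and any `x₀ ∈ ℝ`,
`|μ[x₀,∞) - σ₂[x₀,∞)| ≤ K (ρ(x₀;n₀)/n₀ + ρ(x₀;n₀)^{1/2} ∑_{n=1}^{n₀} |∫ Uₙ dμ|/n)`,
where `ρ(x;n₀) = max(1-|x|, n₀⁻²)` and `Uₙ` are the Chebyshev polynomials of the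
second kind. -/
theorem erdos_turan_semicircle :
    ∃ K : ℝ, 0 < K ∧
      ∀ (μ : Measure ℝ), IsProbabilityMeasure μ →
        (∀ n : ℕ, Integrable (fun x => (Polynomial.Chebyshev.U ℝ n).eval x) μ) →
        ∀ n₀ : ℕ, 1 ≤ n₀ → ∀ x₀ : ℝ,
          |(μ (Set.Ici x₀)).toReal - (semicircleMeasure (Set.Ici x₀)).toReal|
            ≤ K * (max (1 - |x₀|) (((n₀ : ℝ) ^ 2)⁻¹) / n₀
                + Real.sqrt (max (1 - |x₀|) (((n₀ : ℝ) ^ 2)⁻¹))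
                  * ∑ n ∈ Finset.Icc 1 n₀,
                      (n : ℝ)⁻¹ * |∫ x, (Polynomial.Chebyshev.U ℝ n).eval x ∂μ|) := by
  refine ⟨512, by norm_num, fun μ _ hμ d hd x₀ => ?_⟩
  have hd0 : (0 : ℝ) < d := by exact_mod_cast hd
  have main : ∀ x ∈ Set.Icc (-1 : ℝ) 1, 1 - |x| ≤ max (1 - |x₀|) (((d : ℝ) ^ 2)⁻¹) →
      |(μ (Set.Ici x)).toReal - (semicircleMeasure (Set.Ici x)).toReal| ≤
        512 * (max (1 - |x₀|) (((d : ℝ) ^ 2)⁻¹) / d + √(max (1 - |x₀|) (((d : ℝ) ^ 2)⁻¹)) *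
          ∑ n ∈ Finset.Icc 1 d, (n : ℝ)⁻¹ * |∫ x, (Chebyshev.U ℝ n).eval x ∂μ|) := by
    intro x hx hρ
    have hρ0 : ((d : ℝ) ^ 2)⁻¹ ≤ max (1 - |x₀|) (((d : ℝ) ^ 2)⁻¹) := le_max_right _ _
    set ρ := max (1 - |x₀|) (((d : ℝ) ^ 2)⁻¹)
    have hρpos : 0 ≤ ρ := le_trans (by positivity) hρ0
    have h := abs_measure_Ici_cos_sub_le hμ hd (θ := arccos x) (r := √ρ)
      ⟨arccos_nonneg x, arccos_le_pi x⟩ ?_ ?_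
    · rwa [cos_arccos hx.1 hx.2, sq_sqrt hρpos] at h
    · rw [sin_arccos, sqrt_le_iff, mul_pow, sq_sqrt hρpos]
      refine ⟨by positivity, ?_⟩
      have h₁ : |x| ≤ 1 := abs_le.2 hx
      have h₂ : 0 ≤ |x| := abs_nonneg x
      rw [← sq_abs]
      nlinarith
    · exact le_sqrt_of_sq_le (by rwa [inv_pow])
  have hρpos : 0 ≤ max (1 - |x₀|) (((d : ℝ) ^ 2)⁻¹) := le_max_of_le_right (by positivity)
  rcases lt_or_ge x₀ (-1) with h | h
  · refine le_trans ?_ (main (-1) (by simp) (by simp))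
    have hσ : semicircleMeasure (Set.Ici x₀) = semicircleMeasure (Set.Ici (-1)) := by
      rw [← Set.Ico_union_Ici_eq_Ici h.le,
        measure_union (Set.disjoint_left.2 fun x hx hx' => hx.2.not_ge hx') measurableSet_Ici,
        semicircleMeasure_apply_eq_zero measurableSet_Ico fun x hx => by nlinarith [hx.2],
        zero_add]
    have hσ1 : (semicircleMeasure (Set.Ici (-1))).toReal = 1 := by
      rw [← cos_pi, semicircleMeasure_Ici_cos ⟨pi_pos.le, le_rfl⟩, integral_sin_sq]
      simp
    have h₁ : (μ (Set.Ici (-1))).toReal ≤ (μ (Set.Ici x₀)).toReal :=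
      measureReal_mono (Set.Ici_subset_Ici.2 h.le)
    have h₂ : (μ (Set.Ici x₀)).toReal ≤ 1 := measureReal_le_one
    rw [hσ, hσ1, abs_of_nonpos (by linarith), abs_of_nonpos (by linarith)]
    linarith
  · rcases lt_or_ge 1 x₀ with h' | h'
    · refine le_trans ?_ (main 1 (by simp) (by simp))
      have hσ : ∀ y : ℝ, 1 ≤ y → semicircleMeasure (Set.Ici y) = 0 := fun y hy =>
        semicircleMeasure_apply_eq_zero measurableSet_Ici fun x hx => by
          nlinarith [hy.trans (Set.mem_Ici.1 hx)]
      have h₁ : (μ (Set.Ici x₀)).toReal ≤ (μ (Set.Ici 1)).toReal :=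
        measureReal_mono (Set.Ici_subset_Ici.2 h'.le)
      rw [hσ _ h'.le, hσ _ le_rfl, ENNReal.toReal_zero, sub_zero, sub_zero,
        abs_of_nonneg ENNReal.toReal_nonneg, abs_of_nonneg ENNReal.toReal_nonneg]
      exact h₁
    · exact main x₀ ⟨h, h'⟩ (le_max_left _ _)
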